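/- Consider the online ZO-EG setting: for k = 0,…,N, functions f_k : 2^{[n]} × ℝ^m → ℝ are submodular in their first variable and concave and L_{0y,k}-Lipschitz in their second variable, with Lovász extensions f^L_k in the first variable and saddle points z*_k = (x*_k, y*_k) on Z = [0,1]^n × Y, where Y ⊂ ℝ^m is nonempty convex compact with diameter D_y. Let L_{0y} = max_k L_{0y,k}, assume the subgradients used satisfy ‖g_{x,k}(z)‖ ≤ L₀ for all z ∈ Z and all k, and run the online ZO-EG iterations with constant step sizes h₁, h₂ > 0 and smoothing parameter μ > 0, using f^L_k at step k, producing iterates ẑ_k = (x̂_k, ŷ_k) and z_{k+1}. Then (1/(N+1)) E[ Σ_{k=0}^N ( f^L_k(x̂_k, y*_k) − f^L_k(x*_k, ŷ_k) ) ] ≤ e₀²/(2h₂(N+1)) + μ L_{0y} m^{1/2} + (h₂/2 + h₁)(L₀² + L_{0y}²(m+4)²) + 3 D_z P*_N/(2h₂(N+1)), where e₀ = ‖z₀ − z*₀‖, D_z = (n + D_y²)^{1/2}, P*_N = Σ_{i=1}^N ‖z*_i − z*_{i−1}‖, and the expectation is over all independent Gaussian samples used by the algorithm. -/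

import Mathlib

open MeasureTheory Finset RealInnerProductSpace

/-- The standard Gaussian measure `N(0, I_m)` on `ℝ^m`, with density
`(2π)^{−m/2} e^{−‖u‖²/2}` with respect to the Lebesgue measure. -/
noncomputable def stdGaussian (m : ℕ) : Measure (EuclideanSpace ℝ (Fin m)) :=
  volume.withDensity fun u =>
    ENNReal.ofReal ((2 * Real.pi) ^ (-(m : ℝ) / 2) * Real.exp (-‖u‖ ^ 2 / 2))

/-- The hypercube `[0,1]^n ⊂ ℝ^n`. -/
def hypercube (n : ℕ) : Set (EuclideanSpace ℝ (Fin n)) :=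
  {x | ∀ i, x i ∈ Set.Icc (0 : ℝ) 1}

/-- The Lovász extension of `f : 2^{[n]} × ℝ^m → ℝ` in its first variable:
`f^L(x,y) = ∫₀¹ f(S_τ(x), y) dτ` where `S_τ(x) = {i : x_i > τ}`. -/
noncomputable def lovasz {n : ℕ} {α : Type*} (f : Finset (Fin n) → α → ℝ)
    (x : EuclideanSpace ℝ (Fin n)) (y : α) : ℝ :=
  ∫ τ in (0:ℝ)..1, f (Finset.univ.filter fun i => τ < x i) y

/-- The zeroth-order random oracle `((f^L(x, y+μu) − f^L(x,y))/μ) u` estimating the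
gradient of the Gaussian smoothing of `f^L(x, ·)`. -/
noncomputable def oracle {n m : ℕ} (f : Finset (Fin n) → EuclideanSpace ℝ (Fin m) → ℝ)
    (x : EuclideanSpace ℝ (Fin n)) (y : EuclideanSpace ℝ (Fin m)) (μ : ℝ)
    (u : EuclideanSpace ℝ (Fin m)) : EuclideanSpace ℝ (Fin m) :=
  ((lovasz f x (y + μ • u) - lovasz f x y) / μ) • u

/-- `q` is the Euclidean projection of `p` onto the set `C`. -/
def IsProjOn {E : Type*} [NormedAddCommGroup E] (C : Set E) (p q : E) : Prop :=
  q ∈ C ∧ ∀ w ∈ C, ‖p - q‖ ≤ ‖p - w‖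


namespace ZO

lemma proj_inner {E : Type*} [NormedAddCommGroup E] [InnerProductSpace ℝ E] {C : Set E}
    (hC : Convex ℝ C) {p q : E} (h : IsProjOn C p q) : ∀ w ∈ C, ⟪p - q, w - q⟫ ≤ 0 := by
  rw [← norm_eq_iInf_iff_real_inner_le_zero hC h.1]
  have : Nonempty C := ⟨⟨q, h.1⟩⟩
  apply le_antisymm
  · exact le_ciInf fun w => h.2 w w.2
  · exact ciInf_le (f := fun w : C => ‖p - w‖)
      ⟨0, Set.forall_mem_range.2 fun _ => norm_nonneg _⟩ ⟨q, h.1⟩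

lemma proj_nonexp {E : Type*} [NormedAddCommGroup E] [InnerProductSpace ℝ E] {C : Set E}
    (hC : Convex ℝ C) {p q p' q' : E} (h : IsProjOn C p q) (h' : IsProjOn C p' q') :
    ‖q - q'‖ ≤ ‖p - p'‖ := by
  have a := proj_inner hC h q' h'.1
  have b := proj_inner hC h' q h.1
  have e : ⟪p - q, q' - q⟫ + ⟪p' - q', q - q'⟫ = ‖q - q'‖ ^ 2 - ⟪p - p', q - q'⟫ := by
    rw [← real_inner_self_eq_norm_sq]
    simp only [inner_sub_left, inner_sub_right]
    ring
  have c := real_inner_le_norm (p - p') (q - q')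
  by_contra! hlt
  nlinarith [norm_nonneg (q - q'), norm_nonneg (p - p')]

lemma proj_self {E : Type*} [NormedAddCommGroup E] {C : Set E} {p : E} (h : p ∈ C) :
    IsProjOn C p p := ⟨h, fun w _ => by simp⟩

lemma proj_unique {E : Type*} [NormedAddCommGroup E] [InnerProductSpace ℝ E] {C : Set E}
    (hC : Convex ℝ C) {p q q' : E} (h : IsProjOn C p q) (h' : IsProjOn C p q') : q = q' := by
  have := proj_nonexp hC h h'
  rw [sub_self, norm_zero] at this
  exact sub_eq_zero.1 (norm_le_zero_iff.1 this)

noncomputable def proj {E : Type*} [NormedAddCommGroup E] (C : Set E) (p : E) : E :=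
  haveI : Nonempty E := ⟨0⟩
  Classical.epsilon (IsProjOn C p)

lemma proj_spec {E : Type*} [NormedAddCommGroup E] {C : Set E} (hne : C.Nonempty)
    (hc : IsCompact C) (p : E) : IsProjOn C p (proj C p) := by
  obtain ⟨q, hq, hm⟩ := hc.exists_isMinOn hne (f := fun w => ‖p - w‖) (by fun_prop)
  exact Classical.epsilon_spec (p := IsProjOn C p) ⟨q, hq, fun w hw => hm hw⟩

lemma hypercube_convex (n : ℕ) : Convex ℝ (hypercube n) := by
  intro x hx y hy a b ha hb hab i
  have := (convex_Icc (0:ℝ) 1) (hx i) (hy i) ha hb hab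
  simpa using this

lemma hypercube_zero (n : ℕ) : (0 : EuclideanSpace ℝ (Fin n)) ∈ hypercube n := by
  intro i; simp

lemma hypercube_compact (n : ℕ) : IsCompact (hypercube n) := by
  have h : IsCompact (Set.univ.pi fun _ : Fin n => Set.Icc (0:ℝ) 1) :=
    isCompact_univ_pi fun _ => isCompact_Icc
  have := h.image (PiLp.continuous_toLp 2 (fun _ : Fin n => ℝ))
  convert! this using 1
  ext x
  constructor
  · intro hx
    exact ⟨fun i => x i, fun i _ => hx i, rfl⟩
  · rintro ⟨v, hv, rfl⟩ i
    exact hv i trivial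

lemma hypercube_dist {n : ℕ} {x y : EuclideanSpace ℝ (Fin n)} (hx : x ∈ hypercube n)
    (hy : y ∈ hypercube n) : ‖x - y‖ ^ 2 ≤ n := by
  rw [EuclideanSpace.norm_sq_eq]
  calc _ ≤ ∑ i : Fin n, (1:ℝ) := by
        apply Finset.sum_le_sum
        intro i _
        have h1 := hx i
        have h2 := hy i
        simp only [PiLp.sub_apply, Real.norm_eq_abs, sq_abs]
        nlinarith [h1.1, h1.2, h2.1, h2.2]
    _ = n := by simp

lemma dp {Ω : Type*} [MeasurableSpace Ω] (ν : Measure Ω) [IsProbabilityMeasure ν] {S : Type*}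
    (good : S → Prop) : ∀ (N : ℕ) (T : ℕ → S → Ω → S) (c : ℕ → S → Ω → ℝ) (W : ℕ → S → ℝ)
    (e : ℕ → ℝ),
    (∀ k < N, ∀ s, good s → ∀ a, good (T k s a)) →
    (∀ s, good s → 0 ≤ W N s) →
    (∀ k < N, ∀ s, good s → ∃ H : Ω → ℝ, Integrable H ν ∧
      (∀ a, c k s a + W (k + 1) (T k s a) ≤ H a) ∧ ∫ a, H a ∂ν ≤ W k s + e k) →
    ∀ s, good s → ∀ F : (Fin N → Ω) → ℝ, Integrable F (Measure.pi fun _ => ν) →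
    (∀ ω, ∀ Z : ℕ → S, Z 0 = s → (∀ k : Fin N, Z ((k : ℕ) + 1) = T k (Z k) (ω k)) →
      F ω ≤ ∑ k : Fin N, c k (Z k) (ω k)) →
    ∫ ω, F ω ∂(Measure.pi fun _ => ν) ≤ W 0 s + ∑ k ∈ Finset.range N, e k := by
  intro N
  induction N with
  | zero =>
    intro T c W e hT hW hH s hs F hF hb
    have h0 : ∀ ω, F ω ≤ 0 := fun ω => by
      simpa using hb ω (fun _ => s) rfl (fun k => k.elim0)
    calc _ ≤ (0:ℝ) := integral_nonpos h0
      _ ≤ _ := by simpa using hW s hs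
  | succ N ih =>
    intro T c W e hT hW hH s hs F hF hb
    have mp := (measurePreserving_piFinSuccAbove (fun _ : Fin (N+1) => ν) 0).symm
    rw [← mp.integral_comp']
    have hF' : Integrable
        (fun z => F ((MeasurableEquiv.piFinSuccAbove (fun _ : Fin (N+1) => Ω) 0).symm z))
        (ν.prod (Measure.pi fun _ => ν)) := (mp.integrable_comp_emb (MeasurableEquiv.measurableEmbedding _)).2 hF
    rw [integral_prod _ hF']
    obtain ⟨H, Hint, Hle, HI⟩ := hH 0 (Nat.succ_pos N) s hs
    rw [Finset.sum_range_succ']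
    have key : ∀ᵐ a ∂ν, ∫ w, F ((MeasurableEquiv.piFinSuccAbove (fun _ => Ω) 0).symm (a, w))
        ∂(Measure.pi fun _ => ν) ≤ H a + ∑ k ∈ Finset.range N, e (k + 1) := by
      filter_upwards [hF'.prod_right_ae] with a ha
      have := ih (fun k => T (k+1)) (fun k => c (k+1)) (fun k => W (k+1)) (fun k => e (k+1))
        (fun k hk => hT (k+1) (by omega)) hW (fun k hk => hH (k+1) (by omega)) (T 0 s a)
        (hT 0 (Nat.succ_pos N) s hs a)
        (fun w => F ((MeasurableEquiv.piFinSuccAbove (fun _ => Ω) 0).symm (a, w)) - c 0 s a)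
        (ha.sub (integrable_const _)) (by
          intro w Z hZ0 hZ
          have := hb ((MeasurableEquiv.piFinSuccAbove (fun _ => Ω) 0).symm (a, w))
            (fun k => Nat.casesOn k s Z) rfl (by
              intro k
              refine Fin.cases ?_ ?_ k
              · simpa using hZ0
              · intro j
                simpa using hZ j)
          rw [Fin.sum_univ_succ] at this
          simp at this ⊢
          linarith)
      rw [integral_sub ha (integrable_const _)] at this
      simp only [integral_const, probReal_univ, one_smul, zero_add] at this
      have h2 := Hle a
      simp only [zero_add] at h2
      linarith
    calc _ ≤ ∫ a, (H a + ∑ k ∈ Finset.range N, e (k + 1)) ∂ν :=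
          integral_mono_ae hF'.integral_prod_left (Hint.add (integrable_const _)) key
      _ = ∫ a, H a ∂ν + ∑ k ∈ Finset.range N, e (k + 1) := by
          rw [integral_add Hint (integrable_const _)]; simp
      _ ≤ _ := by linarith

local notation "𝔼" m => EuclideanSpace ℝ (Fin m)

noncomputable def dens (m : ℕ) (u : 𝔼 m) : ℝ :=
  (2 * Real.pi) ^ (-(m : ℝ) / 2) * Real.exp (-‖u‖ ^ 2 / 2)

lemma dens_nonneg (m : ℕ) (u : 𝔼 m) : 0 ≤ dens m u := by unfold dens; positivity

lemma dens_cont (m : ℕ) : Continuous (dens m) := by unfold dens; fun_prop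

lemma std_integral {m : ℕ} (h : (𝔼 m) → ℝ) :
    ∫ u, h u ∂(stdGaussian m) = ∫ u, dens m u * h u := by
  have hm : Measurable fun u => ENNReal.ofReal (dens m u) :=
    (dens_cont m).measurable.ennreal_ofReal
  have := integral_withDensity_eq_integral_toReal_smul (μ := volume) hm
    (by simp) h
  simp only [ENNReal.toReal_ofReal (dens_nonneg m _), smul_eq_mul] at this
  exact this

lemma std_integrable {m : ℕ} (h : (𝔼 m) → ℝ) :
    Integrable h (stdGaussian m) ↔ Integrable (fun u => h u * dens m u) := by
  have hm : Measurable fun u => ENNReal.ofReal (dens m u) :=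
    (dens_cont m).measurable.ennreal_ofReal
  have := integrable_withDensity_iff (μ := volume) hm
    (by simp) (g := h)
  simp only [ENNReal.toReal_ofReal (dens_nonneg m _)] at this
  exact this

lemma std_mgf {m : ℕ} {s : ℝ} (hs : s < 1) :
    ∫ u, Real.exp (s * ‖u‖ ^ 2 / 2) ∂(stdGaussian m) = (1 - s) ^ (-(m : ℝ) / 2) := by
  rw [std_integral]
  have hb : 0 < (1 - s) / 2 := by linarith
  have := GaussianFourier.integral_rexp_neg_mul_sq_norm (V := 𝔼 m) hb
  have e : ∀ u : 𝔼 m, dens m u * Real.exp (s * ‖u‖ ^ 2 / 2) =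
      (2 * Real.pi) ^ (-(m : ℝ) / 2) * Real.exp (-((1 - s) / 2) * ‖u‖ ^ 2) := by
    intro u
    rw [dens, mul_assoc, ← Real.exp_add]
    congr 2
    ring
  simp_rw [e]
  rw [integral_const_mul, this]
  simp only [finrank_euclideanSpace, Fintype.card_fin]
  have : Real.pi / ((1 - s) / 2) = (2 * Real.pi) * (1 - s)⁻¹ := by
    field_simp
  rw [this, Real.mul_rpow (by positivity) (inv_nonneg.2 (by linarith)), ← mul_assoc,
    ← Real.rpow_add (by positivity), Real.inv_rpow (by linarith), ← Real.rpow_neg (by linarith)]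
  have : -(m:ℝ)/2 + m/2 = 0 := by ring
  rw [this, Real.rpow_zero, one_mul]
  congr 1
  ring

lemma std_exp_integrable {m : ℕ} {s : ℝ} (hs : s < 1) :
    Integrable (fun u : 𝔼 m => Real.exp (s * ‖u‖ ^ 2 / 2)) (stdGaussian m) := by
  by_contra h
  have h1 := integral_undef h
  rw [std_mgf hs] at h1
  have : 0 < (1 - s) ^ (-(m : ℝ) / 2) := Real.rpow_pos_of_pos (by linarith) _
  linarith

instance std_prob (m : ℕ) : IsProbabilityMeasure (stdGaussian m) := by
  have h0 := std_mgf (m := m) (s := 0) (by norm_num)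
  have hi := std_exp_integrable (m := m) (s := 0) (by norm_num)
  simp at h0 hi
  simpa [Measure.real] using (show (stdGaussian m).real Set.univ = 1 from h0) |> fun h => (⟨by
    have := h
    rw [Measure.real, ENNReal.toReal_eq_one_iff] at this
    exact this⟩ : IsProbabilityMeasure (stdGaussian m))

lemma std_dom {m : ℕ} {h : (𝔼 m) → ℝ} (hc : Continuous h) (C B : ℝ)
    (hb : ∀ u, |h u| ≤ C * Real.exp (B * ‖u‖)) : Integrable h (stdGaussian m) := by
  have hi := (std_exp_integrable (m := m) (s := 1/2) (by norm_num)).const_mul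
    (C * Real.exp (B ^ 2))
  refine hi.mono' hc.aestronglyMeasurable (ae_of_all _ fun u => ?_)
  have hC : 0 ≤ C := by
    have := (abs_nonneg _).trans (hb u)
    exact nonneg_of_mul_nonneg_left this (Real.exp_pos _)
  rw [Real.norm_eq_abs]
  refine (hb u).trans ?_
  rw [mul_assoc, ← Real.exp_add]
  gcongr
  nlinarith [sq_nonneg (B - ‖u‖/2)]

lemma std_pow_integrable (m k : ℕ) : Integrable (fun u : 𝔼 m => ‖u‖ ^ k) (stdGaussian m) := by
  refine std_dom (by fun_prop) (k.factorial) 1 fun u => ?_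
  rw [abs_of_nonneg (by positivity), one_mul]
  have := Real.pow_div_factorial_le_exp (‖u‖) (norm_nonneg u) k
  have hk : (0:ℝ) < k.factorial := by positivity
  rw [div_le_iff₀ hk] at this
  linarith

lemma std_norm_sq (m : ℕ) : ∫ u, ‖u‖ ^ 2 ∂(stdGaussian m) ≤ m := by
  set M := ∫ u, ‖u‖ ^ 2 ∂(stdGaussian m)
  have hs : ∀ s : ℝ, 0 < s → s < 1 → M / 2 ≤ ((1 - s) ^ (-(m : ℝ) / 2) - 1) / s := by
    intro s h0 h1
    rw [le_div_iff₀ h0, ← std_mgf h1]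
    have : ∫ u, (1 + s / 2 * ‖u‖ ^ 2) ∂(stdGaussian m) ≤
        ∫ u, Real.exp (s * ‖u‖ ^ 2 / 2) ∂(stdGaussian m) := by
      refine integral_mono ((integrable_const _).add ((std_pow_integrable m 2).const_mul _))
        (std_exp_integrable h1) fun u => ?_
      have := Real.add_one_le_exp (s * ‖u‖ ^ 2 / 2)
      simp only
      linarith
    rw [integral_add (integrable_const _) ((std_pow_integrable m 2).const_mul _),
      integral_const_mul] at this
    simp at this
    linarith
  have hd : HasDerivAt (fun s : ℝ => (1 - s) ^ (-(m : ℝ) / 2)) ((m:ℝ)/2) 0 := by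
    have h := ((hasDerivAt_id (0:ℝ)).const_sub 1).rpow_const (p := -(m : ℝ) / 2) (by simp)
    convert! h using 1
    simp
    ring
  have ht := hd.tendsto_slope_zero_right
  have : M / 2 ≤ (m:ℝ)/2 := by
    refine ge_of_tendsto ht ?_
    have : Set.Ioo (0:ℝ) 1 ∈ nhdsWithin (0:ℝ) (Set.Ioi 0) := Ioo_mem_nhdsGT one_pos
    filter_upwards [this] with s hs'
    have := hs s hs'.1 hs'.2
    simpa [div_eq_inv_mul] using this
  linarith

lemma std_norm (m : ℕ) : ∫ u, ‖u‖ ∂(stdGaussian m) ≤ Real.sqrt m := by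
  set A := ∫ u, ‖u‖ ∂(stdGaussian m) with hA
  have i1 : Integrable (fun u : 𝔼 m => ‖u‖) (stdGaussian m) := by
    simpa using std_pow_integrable m 1
  have : 0 ≤ ∫ u, (‖u‖ - A) ^ 2 ∂(stdGaussian m) := integral_nonneg fun u => sq_nonneg _
  have e : ∫ u, (‖u‖ - A) ^ 2 ∂(stdGaussian m) =
      ∫ u, ((‖u‖ ^ 2 - (2 * A) * ‖u‖) + A ^ 2) ∂(stdGaussian m) := by
    congr 1; ext u; ring
  rw [e, integral_add (by exact ((std_pow_integrable m 2).sub (i1.const_mul _)))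
    (integrable_const _), integral_sub (std_pow_integrable m 2) (i1.const_mul _),
    integral_const_mul, ← hA] at this
  simp at this
  apply Real.le_sqrt_of_sq_le
  have := std_norm_sq m
  nlinarith

lemma std_norm_four (m : ℕ) : ∫ u, ‖u‖ ^ 4 ∂(stdGaussian m) ≤ ((m:ℝ) + 4) ^ 2 := by
  rcases Nat.eq_zero_or_pos m with rfl | hm
  · have : ∀ u : 𝔼 0, ‖u‖ ^ 4 = 0 := fun u => by
      rw [Subsingleton.elim u 0]; simp
    simp_rw [this]
    simp
  have hm' : (0:ℝ) < m := by exact_mod_cast hm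
  set s : ℝ := 4 / (m + 4) with hs
  have hs0 : 0 < s := by positivity
  have hs1 : s < 1 := by rw [hs, div_lt_one (by positivity)]; linarith
  have hpt : ∀ u : 𝔼 m, ‖u‖ ^ 4 ≤ (16 / s ^ 2 * Real.exp (-2)) * Real.exp (s * ‖u‖ ^ 2 / 2) := by
    intro u
    have h := Real.add_one_le_exp (s * ‖u‖ ^ 2 / 4 - 1)
    have h0 : 0 ≤ s * ‖u‖ ^ 2 / 4 := by positivity
    have h2 : (s * ‖u‖ ^ 2 / 4) ^ 2 ≤ (Real.exp (s * ‖u‖ ^ 2 / 4 - 1)) ^ 2 := by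
      apply pow_le_pow_left₀ h0; linarith
    rw [← Real.exp_nat_mul] at h2
    rw [mul_assoc, ← Real.exp_add]
    have e : ((2:ℕ):ℝ) * (s * ‖u‖ ^ 2 / 4 - 1) = -2 + s * ‖u‖ ^ 2 / 2 := by push_cast; ring
    rw [e] at h2
    calc ‖u‖ ^ 4 = 16 / s ^ 2 * (s * ‖u‖ ^ 2 / 4) ^ 2 := by field_simp; norm_num
      _ ≤ _ := by gcongr
  have hI := integral_mono (std_pow_integrable m 4) ((std_exp_integrable hs1).const_mul _) hpt
  rw [integral_const_mul, std_mgf hs1] at hI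
  refine hI.trans ?_
  have h1s : 1 - s = (1 + 4 / (m:ℝ))⁻¹ := by rw [hs]; field_simp; ring
  have hle : (1 - s) ^ (-(m : ℝ) / 2) ≤ Real.exp 2 := by
    rw [h1s, Real.inv_rpow (by positivity), ← Real.rpow_neg (by positivity)]
    calc (1 + 4 / (m:ℝ)) ^ (-(-(m:ℝ) / 2)) ≤ (Real.exp (4 / m)) ^ (-(-(m:ℝ) / 2)) := by
          apply Real.rpow_le_rpow (by positivity)
          · have := Real.add_one_le_exp (4 / (m:ℝ)); linarith
          · rw [neg_div, neg_neg]; positivity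
      _ = Real.exp 2 := by
          rw [← Real.exp_mul]; congr 1; field_simp; norm_num
  calc _ ≤ (16 / s ^ 2 * Real.exp (-2)) * Real.exp 2 := by gcongr
    _ = 16 / s ^ 2 := by rw [mul_assoc, ← Real.exp_add]; simp
    _ = ((m:ℝ) + 4) ^ 2 := by rw [hs]; field_simp; norm_num
    _ ≤ _ := le_rfl

lemma lovasz_ii {n : ℕ} {α : Type*} (f : Finset (Fin n) → α → ℝ)
    (x : EuclideanSpace ℝ (Fin n)) (y : α) :
    IntervalIntegrable (fun τ : ℝ => f (Finset.univ.filter fun i => τ < x i) y) volume 0 1 := by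
  have hm : Measurable (fun τ : ℝ => f (Finset.univ.filter fun i => τ < x i) y) := by
    have e : (fun τ : ℝ => f (Finset.univ.filter fun i => τ < x i) y) =
        fun τ : ℝ => ∑ S : Finset (Fin n), Set.indicator
          (⋂ i : Fin n, {τ : ℝ | τ < x i ↔ i ∈ S}) (fun _ => f S y) τ := by
      ext τ
      rw [Finset.sum_eq_single (Finset.univ.filter fun i => τ < x i)]
      · rw [Set.indicator_of_mem]
        simp
      · intro S _ hS
        apply Set.indicator_of_notMem
        intro h
        apply hS
        simp only [Set.mem_iInter, Set.mem_ofPred_eq] at h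
        ext i
        simp [h i]
      · simp
    rw [e]
    refine Finset.measurable_sum _ fun S _ => ?_
    refine measurable_const.indicator (MeasurableSet.iInter fun i => ?_)
    by_cases hi : i ∈ S
    · have : {τ : ℝ | τ < x i ↔ i ∈ S} = Set.Iio (x i) := by ext τ; simp [hi]
      rw [this]; exact measurableSet_Iio
    · have : {τ : ℝ | τ < x i ↔ i ∈ S} = Set.Ici (x i) := by ext τ; simp [hi]
      rw [this]; exact measurableSet_Ici
  obtain ⟨C, hC⟩ : ∃ C, ∀ S, |f S y| ≤ C :=
    ⟨∑ S, |f S y|, fun S => Finset.single_le_sum (f := fun S => |f S y|)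
      (fun _ _ => abs_nonneg _) (Finset.mem_univ S)⟩
  rw [intervalIntegrable_iff]
  refine Measure.integrableOn_of_bounded (M := C) (by simp) hm.aestronglyMeasurable
    (ae_of_all _ fun τ => ?_)
  exact hC _

lemma lovasz_lip {n : ℕ} {m : ℕ} {f : Finset (Fin n) → (𝔼 m) → ℝ} {L : ℝ}
    (hL : ∀ S y y', |f S y - f S y'| ≤ L * ‖y - y'‖) (x : EuclideanSpace ℝ (Fin n)) (y y' : 𝔼 m) :
    |lovasz f x y - lovasz f x y'| ≤ L * ‖y - y'‖ := by
  unfold lovasz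
  rw [← intervalIntegral.integral_sub (lovasz_ii f x y) (lovasz_ii f x y')]
  have := intervalIntegral.norm_integral_le_of_norm_le_const (a := (0:ℝ)) (b := 1)
    (C := L * ‖y - y'‖) (f := fun τ : ℝ => f (Finset.univ.filter fun i => τ < x i) y -
      f (Finset.univ.filter fun i => τ < x i) y') (fun τ _ => hL _ _ _)
  simpa using this

lemma lovasz_conc {n : ℕ} {m : ℕ} {f : Finset (Fin n) → (𝔼 m) → ℝ}
    (hf : ∀ S, ConcaveOn ℝ Set.univ (f S)) (x : EuclideanSpace ℝ (Fin n)) :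
    ConcaveOn ℝ Set.univ (lovasz f x) := by
  refine ⟨convex_univ, fun y _ y' _ a b ha hb hab => ?_⟩
  unfold lovasz
  simp only [smul_eq_mul]
  rw [← intervalIntegral.integral_const_mul, ← intervalIntegral.integral_const_mul,
    ← intervalIntegral.integral_add ((lovasz_ii f x y).const_mul a)
      ((lovasz_ii f x y').const_mul b)]
  refine intervalIntegral.integral_mono_on zero_le_one (((lovasz_ii f x y).const_mul a).add
    ((lovasz_ii f x y').const_mul b)) (lovasz_ii f x _) fun τ _ => ?_
  exact (hf _).2 (Set.mem_univ y) (Set.mem_univ y') ha hb hab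

lemma std_shift {m : ℕ} (ψ : (𝔼 m) → ℝ) (v : 𝔼 m) :
    ∫ u, ψ (u + v) ∂(stdGaussian m) =
      ∫ u, ψ u * Real.exp (⟪u, v⟫ - ‖v‖ ^ 2 / 2) ∂(stdGaussian m) := by
  rw [std_integral, std_integral, ← integral_sub_right_eq_self _ v]
  congr 1
  ext u
  simp only [sub_add_cancel]
  have : dens m (u - v) = dens m u * Real.exp (⟪u, v⟫ - ‖v‖ ^ 2 / 2) := by
    unfold dens
    rw [mul_assoc, ← Real.exp_add]
    congr 2
    rw [norm_sub_sq_real]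
    ring
  rw [this]
  ring

lemma std_neg {m : ℕ} (ψ : (𝔼 m) → ℝ) :
    ∫ u, ψ (-u) ∂(stdGaussian m) = ∫ u, ψ u ∂(stdGaussian m) := by
  rw [std_integral, std_integral, ← integral_neg_eq_self]
  congr 1
  ext u
  simp [dens]

lemma smoothing {m : ℕ} {φ : (𝔼 m) → ℝ} (hφ : ConcaveOn ℝ Set.univ φ) {L : ℝ} (hL0 : 0 ≤ L)
    (hL : ∀ y y', |φ y - φ y'| ≤ L * ‖y - y'‖) {μ : ℝ} (hμ : 0 < μ) (y ys : 𝔼 m) :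
    φ ys - φ y + ∫ u, ⟪((φ (y + μ • u) - φ y) / μ) • u, y - ys⟫ ∂(stdGaussian m)
      ≤ μ * L * Real.sqrt m := by
  have hcont : Continuous φ := by
    refine LipschitzWith.continuous (K := L.toNNReal) (LipschitzWith.of_dist_le_mul fun a b => ?_)
    rw [Real.dist_eq, dist_eq_norm, Real.coe_toNNReal L hL0]
    exact hL a b
  set e : 𝔼 m := (1 / μ) • (ys - y) with he
  set ψ : (𝔼 m) → ℝ := fun u => φ (y + μ • u) - φ y with hψ
  have hψc : Continuous ψ := by fun_prop
  have hψb : ∀ u, |ψ u| ≤ L * μ * ‖u‖ := fun u => by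
    have := hL (y + μ • u) y
    rw [add_sub_cancel_left, norm_smul, Real.norm_eq_abs, abs_of_pos hμ] at this
    simp only [hψ]
    linarith
  have hexp1 : ∀ u : 𝔼 m, ‖u‖ ≤ Real.exp ‖u‖ := fun u => by
    have := Real.add_one_le_exp ‖u‖; linarith
  have hexp2 : ∀ u : 𝔼 m, 1 ≤ Real.exp ‖u‖ := fun u => by
    have := Real.add_one_le_exp ‖u‖; linarith [norm_nonneg u]
  have hin : ∀ u : 𝔼 m, |⟪u, e⟫| ≤ ‖u‖ * ‖e‖ := fun u => abs_real_inner_le_norm u e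
  let F : ℝ → (𝔼 m) → ℝ := fun t u => ψ u * Real.exp (t * ⟪u, e⟫ - t ^ 2 * ‖e‖ ^ 2 / 2)
  let F' : ℝ → (𝔼 m) → ℝ := fun t u =>
    ψ u * (Real.exp (t * ⟪u, e⟫ - t ^ 2 * ‖e‖ ^ 2 / 2) * (⟪u, e⟫ - t * ‖e‖ ^ 2))
  have hFc : ∀ t, Continuous (F t) := fun t => by
    simp only [F]; fun_prop
  have hF'c : ∀ t, Continuous (F' t) := fun t => by
    simp only [F']; fun_prop
  have hshift : ∀ t : ℝ, ∫ u, ψ (u + t • e) ∂(stdGaussian m) = ∫ u, F t u ∂(stdGaussian m) := by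
    intro t
    rw [std_shift]
    congr 1
    ext u
    simp only [F, inner_smul_right, norm_smul, Real.norm_eq_abs, mul_pow, sq_abs]
  have hint : ∀ v, Integrable (fun u => ψ (u + v)) (stdGaussian m) := by
    intro v
    refine std_dom (by fun_prop) (L * μ * (1 + ‖v‖)) 1 fun u => ?_
    calc |ψ (u + v)| ≤ L * μ * ‖u + v‖ := hψb _
      _ ≤ L * μ * (‖u‖ + ‖v‖) := by gcongr; exact norm_add_le _ _
      _ ≤ L * μ * (Real.exp ‖u‖ + ‖v‖ * Real.exp ‖u‖) := by
          gcongr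
          · exact hexp1 u
          · exact le_mul_of_one_le_right (norm_nonneg v) (hexp2 u)
      _ = _ := by rw [one_mul]; ring
  have hder := hasDerivAt_integral_of_dominated_loc_of_deriv_le (μ := stdGaussian m)
    (F := F) (F' := F') (x₀ := (0:ℝ)) (s := Metric.ball 0 1)
    (bound := fun u => L * μ * ‖u‖ * (Real.exp (‖u‖ * ‖e‖) * (‖u‖ * ‖e‖ + ‖e‖ ^ 2)))
    (Metric.ball_mem_nhds _ one_pos)
    (Filter.Eventually.of_forall fun t => (hFc t).aestronglyMeasurable)
    (by simpa [F] using hint 0)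
    (hF'c 0).aestronglyMeasurable
    (ae_of_all _ fun u t ht => by
      simp only [F', norm_mul, Real.norm_eq_abs, Real.abs_exp]
      have ht' : |t| ≤ 1 := by
        rw [mem_ball_zero_iff, Real.norm_eq_abs] at ht; exact ht.le
      gcongr
      · exact hψb u
      · have : t * ⟪u, e⟫ ≤ ‖u‖ * ‖e‖ := by
          calc t * ⟪u, e⟫ ≤ |t * ⟪u, e⟫| := le_abs_self _
            _ = |t| * |⟪u, e⟫| := abs_mul _ _
            _ ≤ 1 * (‖u‖ * ‖e‖) := by gcongr; exact hin u
            _ = _ := one_mul _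
        have : 0 ≤ t ^ 2 * ‖e‖ ^ 2 / 2 := by positivity
        linarith
      · calc |⟪u, e⟫ - t * ‖e‖ ^ 2| ≤ |⟪u, e⟫| + |t * ‖e‖ ^ 2| := abs_sub _ _
          _ ≤ ‖u‖ * ‖e‖ + 1 * ‖e‖ ^ 2 := by
              rw [abs_mul, abs_of_nonneg (sq_nonneg ‖e‖)]
              gcongr
              exact hin u
          _ = _ := by rw [one_mul])
    (by
      refine std_dom (by fun_prop) (L * μ * (‖e‖ + ‖e‖ ^ 2)) (2 + ‖e‖) fun u => ?_
      rw [abs_of_nonneg (by positivity)]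
      calc _ ≤ L * μ * Real.exp ‖u‖ * (Real.exp (‖u‖ * ‖e‖) *
            (Real.exp ‖u‖ * ‖e‖ + Real.exp ‖u‖ * ‖e‖ ^ 2)) := by
            gcongr
            · exact hexp1 u
            · exact hexp1 u
            · exact le_mul_of_one_le_left (by positivity) (hexp2 u)
        _ = L * μ * (‖e‖ + ‖e‖ ^ 2) *
              (Real.exp ‖u‖ * Real.exp ‖u‖ * Real.exp (‖u‖ * ‖e‖)) := by ring
        _ = _ := by
            rw [← Real.exp_add, ← Real.exp_add]
            congr 2
            ring)
    (ae_of_all _ fun u t _ => by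
      have h1 : HasDerivAt (fun t : ℝ => t * ⟪u, e⟫ - t ^ 2 * ‖e‖ ^ 2 / 2)
          (⟪u, e⟫ - t * ‖e‖ ^ 2) t := by
        have := ((hasDerivAt_id t).mul_const ⟪u, e⟫).sub
          (((hasDerivAt_pow 2 t).mul_const (‖e‖ ^ 2)).div_const 2)
        convert! this using 1
        simp
        ring
      exact h1.exp.const_mul (ψ u))
  have hd := hder.2
  set G : ℝ → ℝ := fun t => ∫ u, F t u ∂(stdGaussian m) with hG
  have hGc : ∀ t : ℝ, 0 < t → t < 1 → (1 - t) * G 0 + t * G 1 ≤ G t := by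
    intro t h0 h1
    simp only [hG]
    rw [← hshift 0, ← hshift 1, ← hshift t, ← integral_const_mul, ← integral_const_mul,
      ← integral_add ((hint _).const_mul _) ((hint _).const_mul _)]
    refine integral_mono (((hint _).const_mul _).add ((hint _).const_mul _)) (hint _) fun u => ?_
    simp only [hψ]
    have := hφ.2 (Set.mem_univ (y + μ • (u + (0:ℝ) • e))) (Set.mem_univ (y + μ • (u + (1:ℝ) • e)))
      (show 0 ≤ 1 - t by linarith) h0.le (by ring)
    have e2 : (1 - t) • (y + μ • (u + (0:ℝ) • e)) + t • (y + μ • (u + (1:ℝ) • e)) =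
      y + μ • (u + t • e) := by module
    rw [e2] at this
    simp only [smul_eq_mul] at this
    linarith
  have hslope : G 1 - G 0 ≤ ∫ u, F' 0 u ∂(stdGaussian m) := by
    refine ge_of_tendsto hd.tendsto_slope_zero_right ?_
    have : Set.Ioo (0:ℝ) 1 ∈ nhdsWithin (0:ℝ) (Set.Ioi 0) := Ioo_mem_nhdsGT one_pos
    filter_upwards [this] with t ht
    have h := hGc t ht.1 ht.2
    rw [zero_add, smul_eq_mul, ← div_eq_inv_mul, le_div_iff₀ ht.1]
    linarith
  have hG0 : G 0 ≤ 0 := by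
    have e0 : G 0 = ∫ u, ψ u ∂(stdGaussian m) := by
      simp only [hG]; rw [← hshift 0]; simp
    have i0 : Integrable ψ (stdGaussian m) := by simpa using hint 0
    have i1 : Integrable (fun u => ψ (-u)) (stdGaussian m) := by
      refine std_dom (by fun_prop) (L * μ) 1 fun u => ?_
      refine (hψb _).trans ?_
      rw [norm_neg, one_mul]
      gcongr
      exact hexp1 u
    have : ∫ u, (ψ u + ψ (-u)) ∂(stdGaussian m) ≤ 0 := by
      refine integral_nonpos fun u => ?_
      have := hφ.2 (Set.mem_univ (y + μ • u)) (Set.mem_univ (y + μ • (-u)))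
        (show (0:ℝ) ≤ 1/2 by norm_num) (show (0:ℝ) ≤ 1/2 by norm_num) (by norm_num)
      have e2 : (1/2 : ℝ) • (y + μ • u) + (1/2 : ℝ) • (y + μ • (-u)) = y := by module
      rw [e2] at this
      simp only [smul_eq_mul] at this
      simp only [hψ, Pi.zero_apply]
      linarith
    rw [integral_add i0 i1, std_neg] at this
    linarith
  have hG1 : φ ys - φ y - μ * L * Real.sqrt m ≤ G 1 := by
    simp only [hG]
    rw [← hshift 1]
    have i1 : Integrable (fun u : 𝔼 m => ‖u‖) (stdGaussian m) := by
      simpa using std_pow_integrable m 1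
    have : ∫ u, ((φ ys - φ y) - (L * μ) * ‖u‖) ∂(stdGaussian m) ≤
        ∫ u, ψ (u + (1:ℝ) • e) ∂(stdGaussian m) := by
      refine integral_mono ((integrable_const _).sub (i1.const_mul _)) (hint _) fun u => ?_
      have e2 : y + μ • (u + (1:ℝ) • e) = ys + μ • u := by
        rw [he, one_smul, smul_add, smul_smul, mul_one_div_cancel hμ.ne', one_smul]; abel
      simp only [hψ, e2]
      have := hL ys (ys + μ • u)
      rw [sub_add_cancel_left, norm_neg, norm_smul, Real.norm_eq_abs, abs_of_pos hμ] at this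
      have := (abs_le.1 this).2
      linarith
    rw [integral_sub (integrable_const _) (i1.const_mul _), integral_const_mul] at this
    simp only [integral_const, probReal_univ, one_smul] at this ⊢
    have h3 := mul_le_mul_of_nonneg_left (std_norm m) (by positivity : 0 ≤ L * μ)
    linarith
  have hfin : ∫ u, ⟪((φ (y + μ • u) - φ y) / μ) • u, y - ys⟫ ∂(stdGaussian m) =
      - ∫ u, F' 0 u ∂(stdGaussian m) := by
    rw [← integral_neg]
    congr 1
    ext u
    simp only [F', he, hψ, real_inner_smul_left, real_inner_smul_right]
    rw [← neg_sub ys y, inner_neg_right]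
    simp
    ring
  rw [hfin]
  linarith

lemma oracle_norm {n m : ℕ} {f : Finset (Fin n) → (𝔼 m) → ℝ} {L : ℝ}
    (hlip : ∀ S y y', |f S y - f S y'| ≤ L * ‖y - y'‖) {μ : ℝ} (hμ : 0 < μ)
    (x : 𝔼 n) (y u : 𝔼 m) : ‖oracle f x y μ u‖ ≤ L * ‖u‖ ^ 2 := by
  unfold oracle
  have := lovasz_lip hlip x (y + μ • u) y
  rw [add_sub_cancel_left, norm_smul, Real.norm_eq_abs, abs_of_pos hμ] at this
  rw [norm_smul, Real.norm_eq_abs, abs_div, abs_of_pos hμ]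
  calc _ ≤ (L * (μ * ‖u‖)) / μ * ‖u‖ := by gcongr
    _ = _ := by field_simp

lemma dist_step {E : Type*} [NormedAddCommGroup E] [InnerProductSpace ℝ E] {C : Set E}
    (hC : Convex ℝ C) {x v q w : E} {h : ℝ} (hq : IsProjOn C (x + h • v) q) (hw : w ∈ C) :
    ‖q - w‖ ^ 2 ≤ ‖x - w‖ ^ 2 + 2 * h * ⟪v, x - w⟫ + h ^ 2 * ‖v‖ ^ 2 := by
  have h1 := proj_nonexp hC hq (proj_self hw)
  have h2 : ‖q - w‖ ^ 2 ≤ ‖x + h • v - w‖ ^ 2 := by gcongr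
  have e : x + h • v - w = (x - w) + h • v := by abel
  rw [e, norm_add_sq_real, real_inner_smul_right, norm_smul, mul_pow, Real.norm_eq_abs, sq_abs,
    real_inner_comm] at h2
  linarith

lemma step {n m : ℕ} {f : Finset (Fin n) → (𝔼 m) → ℝ}
    (hconc : ∀ S, ConcaveOn ℝ Set.univ (f S)) {L : ℝ} (hL0 : 0 ≤ L)
    (hlip : ∀ S y y', |f S y - f S y'| ≤ L * ‖y - y'‖)
    {Y : Set (𝔼 m)} (hY : Y.Nonempty) (hYconv : Convex ℝ Y) (hYc : IsCompact Y)
    {Dy : ℝ} (hDy : ∀ a ∈ Y, ∀ b ∈ Y, ‖a - b‖ ≤ Dy)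
    {xs : 𝔼 n} {ys : 𝔼 m} (hxs : xs ∈ hypercube n) (hys : ys ∈ Y)
    {g : (𝔼 n) → (𝔼 m) → (𝔼 n)} {L0 : ℝ}
    (hg_sub : ∀ x ∈ hypercube n, ∀ y ∈ Y, ∀ x' ∈ hypercube n,
      lovasz f x y + ⟪g x y, x' - x⟫ ≤ lovasz f x' y)
    (hg_bd : ∀ x ∈ hypercube n, ∀ y ∈ Y, ‖g x y‖ ≤ L0)
    {h1 h2 μ : ℝ} (hh1 : 0 < h1) (hh2 : 0 < h2) (hμ : 0 < μ)
    {x : 𝔼 n} {y : 𝔼 m} (hx : x ∈ hypercube n) (hy : y ∈ Y)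
    {xh : 𝔼 n} (hxh : xh = proj (hypercube n) (x - h1 • g x y))
    {yh : (𝔼 m) → (𝔼 m)} (hyh : ∀ u, yh u = proj Y (y + h1 • oracle f x y μ u)) :
    ∃ H : (𝔼 m) × (𝔼 m) → ℝ, Integrable H ((stdGaussian m).prod (stdGaussian m)) ∧
      (∀ a, (lovasz f xh ys - lovasz f xs (yh a.1)) +
        (‖proj (hypercube n) (x - h2 • g xh (yh a.1)) - xs‖ ^ 2 +
          ‖proj Y (y + h2 • oracle f xh (yh a.1) μ a.2) - ys‖ ^ 2) / (2 * h2) ≤ H a) ∧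
      ∫ a, H a ∂((stdGaussian m).prod (stdGaussian m)) ≤
        (‖x - xs‖ ^ 2 + ‖y - ys‖ ^ 2) / (2 * h2) + (μ * L * Real.sqrt m +
          (h2 / 2 + h1) * (L0 ^ 2 + L ^ 2 * ((m:ℝ) + 4) ^ 2)) := by
  have hCne : (hypercube n).Nonempty := ⟨0, hypercube_zero n⟩
  have hCc := hypercube_compact n
  have hCv := hypercube_convex n
  have hcont : ∀ x, Continuous (lovasz f x) := fun x => by
    refine LipschitzWith.continuous (K := L.toNNReal) (LipschitzWith.of_dist_le_mul fun a b => ?_)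
    rw [Real.dist_eq, dist_eq_norm, Real.coe_toNNReal L hL0]
    exact lovasz_lip hlip x a b
  have hxhP : IsProjOn (hypercube n) (x - h1 • g x y) xh := hxh ▸ proj_spec hCne hCc _
  have hyhP : ∀ u, IsProjOn Y (y + h1 • oracle f x y μ u) (yh u) := fun u =>
    hyh u ▸ proj_spec hY hYc _
  have hprojc : Continuous (proj Y) := by
    refine LipschitzWith.continuous (K := 1) (LipschitzWith.of_dist_le_mul fun a b => ?_)
    rw [dist_eq_norm, dist_eq_norm, NNReal.coe_one, one_mul]
    exact proj_nonexp hYconv (proj_spec hY hYc a) (proj_spec hY hYc b)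
  have hyhc : Continuous yh := by
    have : yh = fun u => proj Y (y + h1 • oracle f x y μ u) := funext hyh
    rw [this]
    refine hprojc.comp ?_
    unfold oracle
    have := hcont x
    fun_prop
  let B : (𝔼 m) × (𝔼 m) → ℝ := fun a => lovasz f xh ys - lovasz f xh (yh a.1) +
    ⟪oracle f xh (yh a.1) μ a.2, yh a.1 - ys⟫
  have hBc : Continuous B := by
    simp only [B]
    unfold oracle
    have := hcont xh
    fun_prop
  have i2 := std_pow_integrable m 2
  have i4 := std_pow_integrable m 4
  have hDy0 : 0 ≤ Dy := (norm_nonneg _).trans (hDy ys hys ys hys)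
  have iB : Integrable B ((stdGaussian m).prod (stdGaussian m)) := by
    refine Integrable.mono' (g := fun a => L * Dy + (L * Dy) * ‖a.2‖ ^ 2)
      ((integrable_const _).add ((i2.comp_snd _).const_mul _)) hBc.aestronglyMeasurable
      (ae_of_all _ fun a => ?_)
    rw [Real.norm_eq_abs]
    have hd1 := hDy ys hys _ (hyhP a.1).1
    have hd2 := hDy _ (hyhP a.1).1 ys hys
    calc |B a| ≤ |lovasz f xh ys - lovasz f xh (yh a.1)| +
          |⟪oracle f xh (yh a.1) μ a.2, yh a.1 - ys⟫| := abs_add_le _ _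
      _ ≤ L * ‖ys - yh a.1‖ + ‖oracle f xh (yh a.1) μ a.2‖ * ‖yh a.1 - ys‖ :=
          add_le_add (lovasz_lip hlip _ _ _) (abs_real_inner_le_norm _ _)
      _ ≤ L * Dy + (L * ‖a.2‖ ^ 2) * Dy := by
          have := oracle_norm hlip hμ xh (yh a.1) a.2
          gcongr
      _ = _ := by ring
  have iM : Integrable (fun a : (𝔼 m) × (𝔼 m) => ‖a.1‖ ^ 2 * ‖a.2‖ ^ 2)
      ((stdGaussian m).prod (stdGaussian m)) := i2.mul_prod i2
  have i4' : Integrable (fun a : (𝔼 m) × (𝔼 m) => ‖a.2‖ ^ 4)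
      ((stdGaussian m).prod (stdGaussian m)) := i4.comp_snd _
  set K : ℝ := (‖x - xs‖ ^ 2 + ‖y - ys‖ ^ 2) / (2 * h2) + (h2 / 2 + h1) * L0 ^ 2 with hK
  refine ⟨fun a => (B a + (h1 * L ^ 2) * (‖a.1‖ ^ 2 * ‖a.2‖ ^ 2)) +
      ((h2 / 2 * L ^ 2) * ‖a.2‖ ^ 4 + K),
    (iB.add (iM.const_mul _)).add ((i4'.const_mul _).add (integrable_const _)), ?_, ?_⟩
  · rintro ⟨u, v⟩
    have hq := (hyhP u).1
    have hgb := hg_bd xh hxhP.1 (yh u) hq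
    have hgb0 := hg_bd x hx y hy
    have hL00 : 0 ≤ L0 := (norm_nonneg _).trans hgb
    -- x part
    have ex : x - h2 • g xh (yh u) = x + h2 • (-(g xh (yh u))) := by
      rw [smul_neg, sub_eq_add_neg]
    have hX := dist_step hCv (x := x) (v := -(g xh (yh u))) (h := h2)
      (proj_spec hCne hCc _) hxs
    rw [← ex, norm_neg, inner_neg_left] at hX
    have hsg := hg_sub xh hxhP.1 (yh u) hq xs hxs
    have hdx : ‖x - xh‖ ≤ h1 * L0 := by
      have := proj_nonexp hCv (proj_self hx) hxhP
      rw [sub_sub_cancel, norm_smul, Real.norm_eq_abs, abs_of_pos hh1] at this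
      exact this.trans (by gcongr)
    have hix : -(L0 * (h1 * L0)) ≤ ⟪g xh (yh u), x - xh⟫ := by
      have := abs_real_inner_le_norm (g xh (yh u)) (x - xh)
      have h3 : ‖g xh (yh u)‖ * ‖x - xh‖ ≤ L0 * (h1 * L0) := by gcongr
      exact (abs_le.1 (this.trans h3)).1
    have esx : ⟪g xh (yh u), x - xs⟫ = ⟪g xh (yh u), x - xh⟫ - ⟪g xh (yh u), xs - xh⟫ := by
      rw [← inner_sub_right]; congr 1; abel
    have hg2 : ‖g xh (yh u)‖ ^ 2 ≤ L0 ^ 2 := by gcongr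
    -- y part
    have hO := oracle_norm hlip hμ xh (yh u) v
    have hO0 := oracle_norm hlip hμ x y u
    set O := oracle f xh (yh u) μ v with hOdef
    have hYy := dist_step hYconv (x := y) (v := O) (h := h2) (proj_spec hY hYc _) hys
    have hdy : ‖y - yh u‖ ≤ h1 * (L * ‖u‖ ^ 2) := by
      have := proj_nonexp hYconv (proj_self hy) (hyhP u)
      rw [sub_add_cancel_left, norm_neg, norm_smul, Real.norm_eq_abs, abs_of_pos hh1] at this
      exact this.trans (by gcongr)
    have hiy : ⟪O, y - yh u⟫ ≤ (L * ‖v‖ ^ 2) * (h1 * (L * ‖u‖ ^ 2)) := by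
      refine (real_inner_le_norm _ _).trans ?_
      gcongr
    have esy : ⟪O, y - ys⟫ = ⟪O, y - yh u⟫ + ⟪O, yh u - ys⟫ := by
      rw [← inner_add_right]; congr 1; abel
    have hO2 : ‖O‖ ^ 2 ≤ L ^ 2 * ‖v‖ ^ 4 := by
      calc ‖O‖ ^ 2 ≤ (L * ‖v‖ ^ 2) ^ 2 := by gcongr
        _ = _ := by ring
    have hBe : B (u, v) = lovasz f xh ys - lovasz f xh (yh u) + ⟪O, yh u - ys⟫ := rfl
    simp only
    rw [hBe, hK]
    have key : ‖proj (hypercube n) (x - h2 • g xh (yh u)) - xs‖ ^ 2 +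
          ‖proj Y (y + h2 • O) - ys‖ ^ 2 ≤ (‖x - xs‖ ^ 2 + ‖y - ys‖ ^ 2) +
          2 * h2 * (L0 * (h1 * L0) + ⟪g xh (yh u), xs - xh⟫ + h2 / 2 * L0 ^ 2 +
            (L * ‖v‖ ^ 2) * (h1 * (L * ‖u‖ ^ 2)) + ⟪O, yh u - ys⟫ +
            h2 / 2 * (L ^ 2 * ‖v‖ ^ 4)) := by
      have a1 := mul_le_mul_of_nonneg_left hix (by positivity : 0 ≤ 2 * h2)
      have a2 := mul_le_mul_of_nonneg_left hiy (by positivity : 0 ≤ 2 * h2)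
      have a3 := mul_le_mul_of_nonneg_left hg2 (by positivity : 0 ≤ h2 ^ 2)
      have a4 := mul_le_mul_of_nonneg_left hO2 (by positivity : 0 ≤ h2 ^ 2)
      rw [esx] at hX
      rw [esy] at hYy
      linarith
    have key2 : (‖proj (hypercube n) (x - h2 • g xh (yh u)) - xs‖ ^ 2 +
          ‖proj Y (y + h2 • O) - ys‖ ^ 2) / (2 * h2) ≤ (‖x - xs‖ ^ 2 + ‖y - ys‖ ^ 2) / (2 * h2) +
          (L0 * (h1 * L0) + ⟪g xh (yh u), xs - xh⟫ + h2 / 2 * L0 ^ 2 +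
            (L * ‖v‖ ^ 2) * (h1 * (L * ‖u‖ ^ 2)) + ⟪O, yh u - ys⟫ +
            h2 / 2 * (L ^ 2 * ‖v‖ ^ 4)) := by
      rw [div_le_iff₀ (by positivity), add_mul, div_mul_cancel₀ _ (by positivity)]
      linarith
    linarith
  · rw [integral_add (by exact iB.add (iM.const_mul _))
      (by exact (i4'.const_mul _).add (integrable_const _)),
      integral_add iB (iM.const_mul _), integral_add (i4'.const_mul _) (integrable_const _),
      integral_const_mul, integral_const_mul]
    have hBI : ∫ a, B a ∂((stdGaussian m).prod (stdGaussian m)) ≤ μ * L * Real.sqrt m := by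
      rw [integral_prod _ iB]
      have hpt : ∀ u, ∫ v, B (u, v) ∂(stdGaussian m) ≤ μ * L * Real.sqrt m := by
        intro u
        have := smoothing (lovasz_conc hconc xh) hL0 (lovasz_lip hlip xh) hμ (yh u) ys
        simp only [B]
        rw [integral_add (integrable_const _)]
        · simpa [oracle] using this
        · have hc : Continuous fun v => ⟪oracle f xh (yh u) μ v, yh u - ys⟫ := by
            unfold oracle
            have := hcont xh
            fun_prop
          refine Integrable.mono' (i2.const_mul (L * Dy)) hc.aestronglyMeasurable
            (ae_of_all _ fun v => ?_)
          have hd2 := hDy _ (hyhP u).1 ys hys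
          have hO := oracle_norm hlip hμ xh (yh u) v
          rw [Real.norm_eq_abs]
          calc _ ≤ ‖oracle f xh (yh u) μ v‖ * ‖yh u - ys‖ := abs_real_inner_le_norm _ _
            _ ≤ (L * ‖v‖ ^ 2) * Dy := by gcongr
            _ = _ := by ring
      calc _ ≤ ∫ _u, μ * L * Real.sqrt m ∂(stdGaussian m) :=
            integral_mono iB.integral_prod_left (integrable_const _) hpt
        _ = _ := by simp
    have hMI : ∫ a : (𝔼 m) × (𝔼 m), ‖a.1‖ ^ 2 * ‖a.2‖ ^ 2 ∂((stdGaussian m).prod (stdGaussian m))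
        ≤ ((m:ℝ) + 4) ^ 2 := by
      rw [integral_prod_mul (fun u : 𝔼 m => ‖u‖ ^ 2) (fun u : 𝔼 m => ‖u‖ ^ 2)]
      have h0 : 0 ≤ ∫ u, ‖u‖ ^ 2 ∂(stdGaussian m) := integral_nonneg fun u => by positivity
      have := std_norm_sq m
      have hm : (0:ℝ) ≤ m := by positivity
      nlinarith
    have h4I : ∫ a : (𝔼 m) × (𝔼 m), ‖a.2‖ ^ 4 ∂((stdGaussian m).prod (stdGaussian m))
        ≤ ((m:ℝ) + 4) ^ 2 := by
      have : ∫ a : (𝔼 m) × (𝔼 m), ‖a.2‖ ^ 4 ∂((stdGaussian m).prod (stdGaussian m)) =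
        ∫ v, ‖v‖ ^ 4 ∂(stdGaussian m) := by
        rw [integral_fun_snd (fun v : 𝔼 m => ‖v‖ ^ 4)]; simp
      rw [this]
      exact std_norm_four m
    have b1 := mul_le_mul_of_nonneg_left hMI (by positivity : 0 ≤ h1 * L ^ 2)
    have b2 := mul_le_mul_of_nonneg_left h4I (by positivity : 0 ≤ h2 / 2 * L ^ 2)
    have hc : ∫ _a : (𝔼 m) × (𝔼 m), K ∂((stdGaussian m).prod (stdGaussian m)) = K := by simp
    rw [hc, hK]
    linarith

lemma path_step {n m : ℕ} {Y : Set (𝔼 m)} {Dy : ℝ} (hDy : ∀ a ∈ Y, ∀ b ∈ Y, ‖a - b‖ ≤ Dy)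
    {x xs xs' : 𝔼 n} {y ys ys' : 𝔼 m} (hx : x ∈ hypercube n) (hxs : xs ∈ hypercube n)
    (hxs' : xs' ∈ hypercube n) (hy : y ∈ Y) (hys : ys ∈ Y) (hys' : ys' ∈ Y) :
    ‖x - xs'‖ ^ 2 + ‖y - ys'‖ ^ 2 ≤ ‖x - xs‖ ^ 2 + ‖y - ys‖ ^ 2 +
      3 * Real.sqrt ((n:ℝ) + Dy ^ 2) * Real.sqrt (‖xs' - xs‖ ^ 2 + ‖ys' - ys‖ ^ 2) := by
  have tri : ∀ {k : ℕ} (a b c : 𝔼 k), ‖a - c‖ ^ 2 ≤ ‖a - b‖ ^ 2 +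
      ‖c - b‖ * (‖a - c‖ + ‖a - b‖) := by
    intro k a b c
    have h := norm_sub_norm_le (a - c) (a - b)
    rw [sub_sub_sub_cancel_left, norm_sub_rev b c] at h
    nlinarith [norm_nonneg (a - c), norm_nonneg (a - b)]
  have t1 := tri x xs xs'
  have t2 := tri y ys ys'
  have hn : ∀ {a b : 𝔼 n}, a ∈ hypercube n → b ∈ hypercube n → ‖a - b‖ ≤ Real.sqrt n :=
    fun ha hb => Real.le_sqrt_of_sq_le (hypercube_dist ha hb)
  set p := ‖xs' - xs‖
  set q := ‖ys' - ys‖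
  have hp : 0 ≤ p := norm_nonneg _
  have hq : 0 ≤ q := norm_nonneg _
  have hD0 : 0 ≤ Dy := (norm_nonneg _).trans (hDy _ hy _ hy)
  have c1 : p * (‖x - xs'‖ + ‖x - xs‖) ≤ p * (2 * Real.sqrt n) := by
    gcongr; linarith [hn hx hxs', hn hx hxs]
  have c2 : q * (‖y - ys'‖ + ‖y - ys‖) ≤ q * (2 * Dy) := by
    gcongr; linarith [hDy _ hy _ hys', hDy _ hy _ hys]
  have c3 : p * Real.sqrt n + q * Dy ≤
      Real.sqrt ((n:ℝ) + Dy ^ 2) * Real.sqrt (p ^ 2 + q ^ 2) := by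
    rw [← Real.sqrt_mul (by positivity)]
    apply Real.le_sqrt_of_sq_le
    have := Real.sq_sqrt (Nat.cast_nonneg (α := ℝ) n)
    nlinarith [sq_nonneg (p * Dy - q * Real.sqrt n)]
  have c4 : 0 ≤ Real.sqrt ((n:ℝ) + Dy ^ 2) * Real.sqrt (p ^ 2 + q ^ 2) := by positivity
  linarith

end ZO

/-- Online ZO-EG, restricted-gap bound: for submodular-concave Lipschitz functions
`f_k` with Lovász extensions `f^L_k` and saddle points `z*_k = (x*_k, y*_k)` on
`Z = [0,1]^n × Y`, subgradients bounded by `L₀`, the online extragradient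
iterates `ẑ_k = (x̂_k, ŷ_k)` satisfy
`(1/(N+1)) E[Σ_k (f^L_k(x̂_k,y*_k) − f^L_k(x*_k,ŷ_k))] ≤ e₀²/(2h₂(N+1))
+ μ L_{0y} √m + (h₂/2 + h₁)(L₀² + L_{0y}²(m+4)²) + 3 D_z P*_N/(2h₂(N+1))`. -/
theorem zoeg_online_restricted_gap (n m N : ℕ)
    (f : ℕ → Finset (Fin n) → EuclideanSpace ℝ (Fin m) → ℝ)
    (hsub : ∀ k ≤ N, ∀ y, ∀ S T : Finset (Fin n),
      f k (S ∩ T) y + f k (S ∪ T) y ≤ f k S y + f k T y)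
    (hconc : ∀ k ≤ N, ∀ S : Finset (Fin n), ConcaveOn ℝ Set.univ (f k S))
    (L0yk : ℕ → ℝ) (hL0yk : ∀ k ≤ N, 0 < L0yk k)
    (hlip : ∀ k ≤ N, ∀ S : Finset (Fin n), ∀ y y' : EuclideanSpace ℝ (Fin m),
      |f k S y - f k S y'| ≤ L0yk k * ‖y - y'‖)
    (L0y : ℝ)
    (hL0y : L0y = (Finset.range (N + 1)).sup'
      ⟨0, Finset.mem_range.mpr (Nat.succ_pos N)⟩ L0yk)
    (Y : Set (EuclideanSpace ℝ (Fin m))) (hY : Y.Nonempty)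
    (hYconv : Convex ℝ Y) (hYc : IsCompact Y)
    (Dy : ℝ) (hDy : Dy = Metric.diam Y)
    (xstar : ℕ → EuclideanSpace ℝ (Fin n)) (ystar : ℕ → EuclideanSpace ℝ (Fin m))
    (hstar : ∀ k ≤ N, xstar k ∈ hypercube n ∧ ystar k ∈ Y)
    (hsaddle : ∀ k ≤ N, ∀ x ∈ hypercube n, ∀ y ∈ Y,
      lovasz (f k) (xstar k) y ≤ lovasz (f k) (xstar k) (ystar k)
      ∧ lovasz (f k) (xstar k) (ystar k) ≤ lovasz (f k) x (ystar k))
    (g : ℕ → EuclideanSpace ℝ (Fin n) → EuclideanSpace ℝ (Fin m) →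
      EuclideanSpace ℝ (Fin n))
    (L0 : ℝ)
    (hg_sub : ∀ k ≤ N, ∀ x ∈ hypercube n, ∀ y ∈ Y, ∀ x' ∈ hypercube n,
      lovasz (f k) x y + ⟪g k x y, x' - x⟫ ≤ lovasz (f k) x' y)
    (hg_bd : ∀ k ≤ N, ∀ x ∈ hypercube n, ∀ y ∈ Y, ‖g k x y‖ ≤ L0)
    (h1 h2 μ : ℝ) (hh1 : 0 < h1) (hh2 : 0 < h2) (hμ : 0 < μ)
    (x0 : EuclideanSpace ℝ (Fin n)) (y0 : EuclideanSpace ℝ (Fin m))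
    (hx0 : x0 ∈ hypercube n) (hy0 : y0 ∈ Y)
    (X Xh : ℕ → (Fin (N + 1) → EuclideanSpace ℝ (Fin m) × EuclideanSpace ℝ (Fin m)) →
      EuclideanSpace ℝ (Fin n))
    (Yv Yh : ℕ → (Fin (N + 1) → EuclideanSpace ℝ (Fin m) × EuclideanSpace ℝ (Fin m)) →
      EuclideanSpace ℝ (Fin m))
    (hinit : ∀ ω, X 0 ω = x0 ∧ Yv 0 ω = y0)
    (hstep : ∀ k : Fin (N + 1), ∀ ω,
      IsProjOn (hypercube n) (X k ω - h1 • g k (X k ω) (Yv k ω)) (Xh k ω)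
      ∧ IsProjOn Y (Yv k ω + h1 • oracle (f k) (X k ω) (Yv k ω) μ (ω k).1) (Yh k ω)
      ∧ IsProjOn (hypercube n) (X k ω - h2 • g k (Xh k ω) (Yh k ω)) (X (k + 1) ω)
      ∧ IsProjOn Y (Yv k ω + h2 • oracle (f k) (Xh k ω) (Yh k ω) μ (ω k).2)
          (Yv (k + 1) ω)) :
    (1 / ((N : ℝ) + 1)) *
        ∫ ω, (∑ k ∈ Finset.range (N + 1),
            (lovasz (f k) (Xh k ω) (ystar k) - lovasz (f k) (xstar k) (Yh k ω)))
          ∂(Measure.pi fun _ : Fin (N + 1) => (stdGaussian m).prod (stdGaussian m))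
      ≤ (‖x0 - xstar 0‖ ^ 2 + ‖y0 - ystar 0‖ ^ 2) / (2 * h2 * ((N : ℝ) + 1))
        + μ * L0y * Real.sqrt m
        + (h2 / 2 + h1) * (L0 ^ 2 + L0y ^ 2 * ((m : ℝ) + 4) ^ 2)
        + 3 * Real.sqrt ((n : ℝ) + Dy ^ 2) *
            (∑ i ∈ Finset.range N,
              Real.sqrt (‖xstar (i + 1) - xstar i‖ ^ 2 + ‖ystar (i + 1) - ystar i‖ ^ 2))
            / (2 * h2 * ((N : ℝ) + 1)) := by
  have hCne : (hypercube n).Nonempty := ⟨0, ZO.hypercube_zero n⟩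
  have hCc := ZO.hypercube_compact n
  have hCv := ZO.hypercube_convex n
  have hLk : ∀ k ≤ N, L0yk k ≤ L0y := fun k hk => by
    rw [hL0y]
    exact Finset.le_sup' L0yk (Finset.mem_range.2 (by omega))
  have hL0y0 : 0 ≤ L0y := (hL0yk 0 (Nat.zero_le N)).le.trans (hLk 0 (Nat.zero_le N))
  have hlip' : ∀ k ≤ N, ∀ S : Finset (Fin n), ∀ y y' : EuclideanSpace ℝ (Fin m),
      |f k S y - f k S y'| ≤ L0y * ‖y - y'‖ := fun k hk S y y' =>
    (hlip k hk S y y').trans (mul_le_mul_of_nonneg_right (hLk k hk) (norm_nonneg _))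
  have hDy' : ∀ a ∈ Y, ∀ b ∈ Y, ‖a - b‖ ≤ Dy := fun a ha b hb => by
    rw [hDy, ← dist_eq_norm]
    exact Metric.dist_le_diam_of_mem hYc.isBounded ha hb
  have hN1 : (0:ℝ) < (N:ℝ) + 1 := by positivity
  by_cases hF : Integrable (fun ω => ∑ k ∈ Finset.range (N + 1),
      (lovasz (f k) (Xh k ω) (ystar k) - lovasz (f k) (xstar k) (Yh k ω)))
      (Measure.pi fun _ : Fin (N + 1) => (stdGaussian m).prod (stdGaussian m))
  swap
  · rw [integral_undef hF, mul_zero]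
    positivity
  set p : ℕ → ℝ := fun i =>
    Real.sqrt (‖xstar (i + 1) - xstar i‖ ^ 2 + ‖ystar (i + 1) - ystar i‖ ^ 2) with hp
  set D : ℝ := 3 * Real.sqrt ((n : ℝ) + Dy ^ 2) with hD
  set E : ℝ := μ * L0y * Real.sqrt m + (h2 / 2 + h1) * (L0 ^ 2 + L0y ^ 2 * ((m : ℝ) + 4) ^ 2)
    with hE
  let xh : ℕ → (EuclideanSpace ℝ (Fin n) × EuclideanSpace ℝ (Fin m)) → EuclideanSpace ℝ (Fin n) :=
    fun k s => ZO.proj (hypercube n) (s.1 - h1 • g k s.1 s.2)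
  let yh : ℕ → (EuclideanSpace ℝ (Fin n) × EuclideanSpace ℝ (Fin m)) →
      EuclideanSpace ℝ (Fin m) → EuclideanSpace ℝ (Fin m) :=
    fun k s u => ZO.proj Y (s.2 + h1 • oracle (f k) s.1 s.2 μ u)
  let T : ℕ → (EuclideanSpace ℝ (Fin n) × EuclideanSpace ℝ (Fin m)) →
      (EuclideanSpace ℝ (Fin m) × EuclideanSpace ℝ (Fin m)) →
      (EuclideanSpace ℝ (Fin n) × EuclideanSpace ℝ (Fin m)) := fun k s a =>
    (ZO.proj (hypercube n) (s.1 - h2 • g k (xh k s) (yh k s a.1)),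
      ZO.proj Y (s.2 + h2 • oracle (f k) (xh k s) (yh k s a.1) μ a.2))
  let c : ℕ → (EuclideanSpace ℝ (Fin n) × EuclideanSpace ℝ (Fin m)) →
      (EuclideanSpace ℝ (Fin m) × EuclideanSpace ℝ (Fin m)) → ℝ := fun k s a =>
    lovasz (f k) (xh k s) (ystar k) - lovasz (f k) (xstar k) (yh k s a.1)
  let W : ℕ → (EuclideanSpace ℝ (Fin n) × EuclideanSpace ℝ (Fin m)) → ℝ := fun k s =>
    (‖s.1 - xstar (min k N)‖ ^ 2 + ‖s.2 - ystar (min k N)‖ ^ 2) / (2 * h2)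
  let e : ℕ → ℝ := fun k => E + (if k < N then D * p k / (2 * h2) else 0)
  have main := ZO.dp ((stdGaussian m).prod (stdGaussian m))
    (fun s : EuclideanSpace ℝ (Fin n) × EuclideanSpace ℝ (Fin m) => s.1 ∈ hypercube n ∧ s.2 ∈ Y)
    (N + 1) T c W e
    (fun k _ s _ a => ⟨(ZO.proj_spec hCne hCc _).1, (ZO.proj_spec hY hYc _).1⟩)
    (fun s _ => by simp only [W]; positivity)
    (by
      intro k hk s hs
      have hkN : k ≤ N := by omega
      obtain ⟨H, Hi, Hle, HI⟩ := ZO.step (hconc k hkN) hL0y0 (hlip' k hkN) hY hYconv hYc hDy'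
        (hstar k hkN).1 (hstar k hkN).2 (hg_sub k hkN) (hg_bd k hkN) hh1 hh2 hμ hs.1 hs.2
        (xh := xh k s) rfl (yh := yh k s) (fun _ => rfl)
      refine ⟨fun a => H a + (if k < N then D * p k / (2 * h2) else 0),
        Hi.add (integrable_const _), ?_, ?_⟩
      · intro a
        have h := Hle a
        have hW : W (k + 1) (T k s a) ≤
            (‖(T k s a).1 - xstar k‖ ^ 2 + ‖(T k s a).2 - ystar k‖ ^ 2) / (2 * h2) +
              (if k < N then D * p k / (2 * h2) else 0) := by
          simp only [W]
          split_ifs with hlt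
          · rw [min_eq_left (by omega : k + 1 ≤ N), ← add_div]
            refine div_le_div_of_nonneg_right ?_ (by positivity)
            have hk1 := hstar (k + 1) (by omega)
            have hk0 := hstar k hkN
            exact ZO.path_step hDy' (ZO.proj_spec hCne hCc _).1 hk0.1 hk1.1
              (ZO.proj_spec hY hYc _).1 hk0.2 hk1.2
          · have : min (k + 1) N = k := by omega
            rw [this, add_zero]
        simp only [c]
        simp only [T] at hW ⊢
        linarith
      · rw [integral_add Hi (integrable_const _)]
        simp only [integral_const, probReal_univ, one_smul, W, e]
        rw [min_eq_left hkN]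
        linarith)
    (x0, y0) ⟨hx0, hy0⟩ _ hF
    (by
      intro ω Z hZ0 hZ
      have hZk : ∀ k : ℕ, k ≤ N + 1 → Z k = (X k ω, Yv k ω) := by
        intro k
        induction k with
        | zero => intro _; rw [hZ0, (hinit ω).1, (hinit ω).2]
        | succ k ih =>
          intro hk
          have h := hZ ⟨k, by omega⟩
          have hs := hstep ⟨k, by omega⟩ ω
          simp only at h hs
          rw [h, ih (by omega)]
          have exh : xh k (X k ω, Yv k ω) = Xh k ω :=
            ZO.proj_unique hCv (ZO.proj_spec hCne hCc _) hs.1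
          have eyh : yh k (X k ω, Yv k ω) (ω ⟨k, by omega⟩).1 = Yh k ω :=
            ZO.proj_unique hYconv (ZO.proj_spec hY hYc _) hs.2.1
          simp only [T, exh, eyh]
          rw [ZO.proj_unique hCv (ZO.proj_spec hCne hCc _) hs.2.2.1,
            ZO.proj_unique hYconv (ZO.proj_spec hY hYc _) hs.2.2.2]
      rw [Finset.sum_range]
      refine le_of_eq (Finset.sum_congr rfl fun k _ => ?_)
      have hs := hstep k ω
      have exh : xh k (X k ω, Yv k ω) = Xh k ω :=
        ZO.proj_unique hCv (ZO.proj_spec hCne hCc _) hs.1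
      have eyh : yh k (X k ω, Yv k ω) (ω k).1 = Yh k ω :=
        ZO.proj_unique hYconv (ZO.proj_spec hY hYc _) hs.2.1
      rw [hZk k (by omega)]
      simp only [c, exh, eyh])
  have hsum : ∑ k ∈ Finset.range (N + 1), e k =
      ((N:ℝ) + 1) * E + D * (∑ k ∈ Finset.range N, p k) / (2 * h2) := by
    simp only [e]
    rw [Finset.sum_add_distrib, Finset.sum_const, Finset.card_range, Finset.sum_range_succ,
      if_neg (lt_irrefl N), add_zero, nsmul_eq_mul, Finset.mul_sum, Finset.sum_div]
    push_cast
    congr 1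
    refine Finset.sum_congr rfl fun k hk => ?_
    rw [if_pos (Finset.mem_range.1 hk)]
  rw [hsum] at main
  simp only [W, Nat.zero_min] at main
  have h3 := mul_le_mul_of_nonneg_left main (by positivity : 0 ≤ 1 / ((N:ℝ) + 1))
  refine h3.trans (le_of_eq ?_)
  rw [add_assoc _ (μ * L0y * Real.sqrt m), ← hE]
  field_simp
  ring
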